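/- arXiv:math-ph/0612027 — 2 statements merged into one kernel-verified Lean document; each statement's English description precedes it below -/
import Mathlib

section
/- For every nonnegative integer n and every positive integer k, the k-th positive zeros of consecutive Bessel functions satisfy 1 < j_{n+1,k} − j_{n,k} < π/2. -/
open Real MeasureTheory intervalIntegral

/-- The Bessel function of the first kind of (integer) order `n`, defined by its
everywhere-convergent power series. -/
noncomputable def besselJ (n : ℕ) (x : ℝ) : ℝ :=
  ∑' m : ℕ, ((-1 : ℝ) ^ m / (Nat.factorial m * Nat.factorial (m + n))) * (x / 2) ^ (2 * m + n)

/-- `x` is the `k`-th positive zero of `f` (for `k ≥ 1`): `x` is a positive zero of `f`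
and there are exactly `k - 1` positive zeros of `f` below `x`. -/
def IsKthPosZero (f : ℝ → ℝ) (k : ℕ) (x : ℝ) : Prop :=
  0 < x ∧ f x = 0 ∧ {y : ℝ | 0 < y ∧ y < x ∧ f y = 0}.ncard = k - 1

/-- Coefficients of the auxiliary entire function. -/
noncomputable def bC (n m : ℕ) : ℝ :=
  (-1 : ℝ) ^ m / (Nat.factorial m * Nat.factorial (m + n))

/-- The entire function with `J_n(x) = (x/2)^n E_n(x^2/4)`. -/
noncomputable def bE (n : ℕ) (t : ℝ) : ℝ := ∑' m : ℕ, bC n m * t ^ m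

lemma bC_abs_le (n m : ℕ) : |bC n m| ≤ 1 / (Nat.factorial m : ℝ) := by
  unfold bC
  rw [abs_div, abs_pow, abs_neg, abs_one, one_pow, abs_of_pos (by positivity)]
  apply one_div_le_one_div_of_le (by positivity)
  have h1 : (1 : ℝ) ≤ Nat.factorial (m + n) := by
    exact_mod_cast Nat.factorial_pos (m + n)
  have h2 : (0 : ℝ) ≤ Nat.factorial m := by positivity
  nlinarith

lemma bE_summable (n : ℕ) (t : ℝ) : Summable fun m : ℕ => bC n m * t ^ m := by
  refine Summable.of_norm_bounded (Real.summable_pow_div_factorial |t|) ?_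
  intro m
  rw [Real.norm_eq_abs, abs_mul, abs_pow]
  calc |bC n m| * |t| ^ m ≤ 1 / (Nat.factorial m : ℝ) * |t| ^ m := by
        gcongr
        exact bC_abs_le n m
    _ = _ := by ring

lemma bC_succ (n m : ℕ) : bC n (m + 1) * ((m : ℝ) + 1) = - bC (n + 1) m := by
  unfold bC
  rw [Nat.factorial_succ, show m + 1 + n = m + (n + 1) by ring]
  have h1 : (Nat.factorial m : ℝ) ≠ 0 := by positivity
  have h2 : (Nat.factorial (m + (n + 1)) : ℝ) ≠ 0 := by positivity
  have h3 : (m : ℝ) + 1 ≠ 0 := by positivity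
  push_cast
  field_simp
  ring

lemma bE_hasDerivAt (n : ℕ) (t : ℝ) : HasDerivAt (bE n) (- bE (n + 1) t) t := by
  set R : ℝ := |t| + 1 with hR
  have hR0 : 0 < R := by positivity
  have key := hasDerivAt_tsum_of_isPreconnected
    (u := fun m : ℕ => |bC n m| * (m * R ^ (m - 1)))
    (g := fun (m : ℕ) (y : ℝ) => bC n m * y ^ m)
    (g' := fun (m : ℕ) (y : ℝ) => bC n m * (m * y ^ (m - 1)))
    (t := Metric.ball (0 : ℝ) R) (y₀ := 0) (y := t)
    (by
      rw [← summable_nat_add_iff 1]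
      refine Summable.of_norm_bounded (Real.summable_pow_div_factorial R) ?_
      intro m
      have h := bC_succ n m
      have h' : |bC n (m + 1)| * ((m : ℝ) + 1) = |bC (n + 1) m| := by
        rw [← abs_neg (bC (n + 1) m), ← h, abs_mul, abs_of_pos (by positivity : (0 : ℝ) < m + 1)]
      rw [Real.norm_of_nonneg (by positivity)]
      push_cast
      rw [← mul_assoc, h']
      calc |bC (n + 1) m| * R ^ m ≤ 1 / (Nat.factorial m : ℝ) * R ^ m := by
            gcongr
            exact bC_abs_le _ m
        _ = _ := by ring)
    Metric.isOpen_ball (convex_ball _ _).isPreconnected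
    (by
      intro m y _
      exact (hasDerivAt_pow m y).const_mul _)
    (by
      intro m y hy
      rw [mem_ball_zero_iff, Real.norm_eq_abs] at hy
      rw [Real.norm_eq_abs, abs_mul, abs_mul, abs_pow, Nat.abs_cast]
      gcongr)
    (by simpa using hR0) (bE_summable n 0)
    (by rw [mem_ball_zero_iff, Real.norm_eq_abs]; linarith)
  have e : ∑' m : ℕ, bC n m * (m * t ^ (m - 1)) = - bE (n + 1) t := by
    have hs : Summable fun m : ℕ => bC n (m + 1) * (((m + 1 : ℕ) : ℝ) * t ^ (m + 1 - 1)) := by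
      have := (bE_summable (n + 1) t).neg
      refine this.congr ?_
      intro m
      have h := bC_succ n m
      push_cast
      rw [← mul_assoc, h]; ring
    rw [((summable_nat_add_iff 1
      (f := fun m : ℕ => bC n m * (m * t ^ (m - 1)))).1 hs).tsum_eq_zero_add]
    unfold bE
    rw [← tsum_neg]
    simp only [Nat.cast_zero, zero_mul, mul_zero, zero_add]
    congr 1
    ext m
    have h := bC_succ n m
    push_cast
    rw [← mul_assoc, h]; ring
  rw [e] at key
  exact key

lemma bE_rec (n : ℕ) (t : ℝ) :
    ((n : ℝ) + 1) * bE (n + 1) t - t * bE (n + 2) t = bE n t := by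
  have h2 : t * bE (n + 2) t = ∑' m : ℕ, - (bC (n + 1) m * m) * t ^ m := by
    have hh : ∀ m : ℕ, t * (bC (n + 2) m * t ^ m)
        = - (bC (n + 1) (m + 1) * ((m + 1 : ℕ) : ℝ)) * t ^ (m + 1) := by
      intro m
      have h := bC_succ (n + 1) m
      push_cast
      rw [h]; ring
    have hs : Summable fun m : ℕ =>
        - (bC (n + 1) (m + 1) * ((m + 1 : ℕ) : ℝ)) * t ^ (m + 1) :=
      ((bE_summable (n + 2) t).mul_left t).congr hh
    rw [((summable_nat_add_iff 1
      (f := fun m : ℕ => - (bC (n + 1) m * m) * t ^ m)).1 hs).tsum_eq_zero_add]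
    unfold bE
    rw [← tsum_mul_left]
    simp [hh]
  have hs2 : Summable fun m : ℕ => - (bC (n + 1) m * m) * t ^ m := by
    rw [← summable_nat_add_iff 1]
    refine ((bE_summable (n + 2) t).mul_left t).congr ?_
    intro m
    have h := bC_succ (n + 1) m
    push_cast
    rw [h]; ring
  rw [h2]
  unfold bE
  rw [← tsum_mul_left, ← ((bE_summable (n + 1) t).mul_left _).tsum_sub hs2]
  congr 1
  ext m
  have : bC n m = bC (n + 1) m * ((m : ℝ) + n + 1) := by
    unfold bC
    rw [show m + (n + 1) = m + n + 1 by ring, Nat.factorial_succ]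
    push_cast
    field_simp
  rw [this]; ring

lemma bE_zero (n : ℕ) : bE n 0 ≠ 0 := by
  unfold bE
  rw [(bE_summable n 0).tsum_eq_zero_add]
  have : bC n 0 ≠ 0 := by unfold bC; positivity
  simpa using this

lemma bE_analytic (n : ℕ) : AnalyticOnNhd ℝ (bE n) Set.univ := by
  set p := FormalMultilinearSeries.ofScalars ℝ (bC n) with hp
  have hr : p.radius = ⊤ := by
    apply FormalMultilinearSeries.radius_eq_top_of_summable_norm
    intro r
    refine Summable.of_norm_bounded (Real.summable_pow_div_factorial r) ?_
    intro m
    rw [hp, FormalMultilinearSeries.ofScalars_norm, Real.norm_of_nonneg (by positivity),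
      Real.norm_eq_abs]
    calc |bC n m| * (r : ℝ) ^ m ≤ 1 / (Nat.factorial m : ℝ) * (r : ℝ) ^ m := by
          gcongr
          exact bC_abs_le _ m
      _ = _ := by ring
  have h := p.hasFPowerSeriesOnBall (by rw [hr]; simp)
  have e : p.sum = bE n := by
    ext x
    have := FormalMultilinearSeries.ofScalars_sum_eq (bC n) x
    simpa [bE, hp, FormalMultilinearSeries.ofScalarsSum] using this
  rw [e] at h
  have h2 := h.analyticOnNhd
  rw [hr] at h2
  simpa using h2

lemma besselJ_eq (n : ℕ) (x : ℝ) : besselJ n x = (x / 2) ^ n * bE n ((x / 2) ^ 2) := by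
  unfold besselJ bE
  rw [← tsum_mul_left]
  congr 1
  ext m
  rw [← pow_mul, pow_add]
  unfold bC
  ring

lemma besselJ_zero_iff (n : ℕ) {x : ℝ} (hx : 0 < x) :
    besselJ n x = 0 ↔ bE n ((x / 2) ^ 2) = 0 := by
  rw [besselJ_eq]
  have : (x / 2) ^ n ≠ 0 := by positivity
  simp [this]

lemma bE_comp_hasDerivAt (n : ℕ) (x : ℝ) :
    HasDerivAt (fun y : ℝ => bE n ((y / 2) ^ 2)) (-(x / 2) * bE (n + 1) ((x / 2) ^ 2)) x := by
  have h1 : HasDerivAt (fun y : ℝ => (y / 2) ^ 2) (x / 2) x := by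
    have := ((hasDerivAt_id x).div_const 2).pow 2
    refine HasDerivAt.congr_deriv this ?_
    simp; ring
  have := (bE_hasDerivAt n ((x / 2) ^ 2)).comp x h1
  refine HasDerivAt.congr_deriv this ?_
  ring

lemma pow_half_hasDerivAt (k : ℕ) (x : ℝ) :
    HasDerivAt (fun y : ℝ => (y / 2) ^ (k + 1)) (((k : ℝ) + 1) / 2 * (x / 2) ^ k) x := by
  have := ((hasDerivAt_id x).div_const 2).pow (k + 1)
  refine HasDerivAt.congr_deriv this ?_
  simp; ring

/-- `x^(n+1) J_(n+1)`, up to a constant, and its derivative. -/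
lemma up_hasDerivAt (n : ℕ) (x : ℝ) :
    HasDerivAt (fun y : ℝ => (y / 2) ^ (2 * n + 1 + 1) * bE (n + 1) ((y / 2) ^ 2))
      ((x / 2) ^ (2 * n + 1) * bE n ((x / 2) ^ 2)) x := by
  have := (pow_half_hasDerivAt (2 * n + 1) x).mul (bE_comp_hasDerivAt (n + 1) x)
  refine HasDerivAt.congr_deriv this ?_
  rw [← bE_rec n]
  push_cast
  ring

lemma besselJ_deriv (n : ℕ) {x : ℝ} (hx : 0 < x) :
    HasDerivAt (besselJ n) (n / x * besselJ n x - besselJ (n + 1) x) x := by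
  have e : besselJ n = fun y : ℝ => (y / 2) ^ n * bE n ((y / 2) ^ 2) := by
    ext y; exact besselJ_eq n y
  rw [besselJ_eq (n + 1), e]
  rcases n with _ | n
  · have := bE_comp_hasDerivAt 0 x
    simp only [pow_zero, one_mul]
    refine HasDerivAt.congr_deriv this ?_
    simp
  · have := (pow_half_hasDerivAt n x).mul (bE_comp_hasDerivAt (n + 1) x)
    refine HasDerivAt.congr_deriv this ?_
    push_cast
    field_simp
    ring

lemma besselJ_deriv' (n : ℕ) {x : ℝ} (hx : 0 < x) :
    HasDerivAt (besselJ (n + 1)) (besselJ n x - (n + 1) / x * besselJ (n + 1) x) x := by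
  have h := besselJ_deriv (n + 1) hx
  refine HasDerivAt.congr_deriv h ?_
  rw [besselJ_eq, besselJ_eq, besselJ_eq, ← bE_rec n]
  push_cast
  field_simp
  ring

lemma zeros_finite (n : ℕ) (x : ℝ) : {y : ℝ | 0 < y ∧ y < x ∧ besselJ n y = 0}.Finite := by
  by_contra hinf
  have hinf : {y : ℝ | 0 < y ∧ y < x ∧ besselJ n y = 0}.Infinite := hinf
  have hsub : {y : ℝ | 0 < y ∧ y < x ∧ besselJ n y = 0} ⊆ Set.Icc 0 x :=
    fun y hy => ⟨hy.1.le, hy.2.1.le⟩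
  obtain ⟨c, _, hc⟩ := hinf.exists_accPt_of_subset_isCompact isCompact_Icc hsub
  rw [accPt_iff_frequently_nhdsNE] at hc
  have han : AnalyticOnNhd ℝ (fun y : ℝ => bE n ((y / 2) ^ 2)) Set.univ := by
    intro y _
    have h1 : AnalyticAt ℝ (fun y : ℝ => (y / 2) ^ 2) y := by fun_prop
    exact AnalyticAt.comp (g := bE n) (f := fun y : ℝ => (y / 2) ^ 2)
      (bE_analytic n ((y / 2) ^ 2) (Set.mem_univ _)) h1
  have := han.eqOn_zero_of_preconnected_of_frequently_eq_zero isPreconnected_univ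
    (Set.mem_univ c) (hc.mono fun y hy => (besselJ_zero_iff n hy.1).1 hy.2.2)
  have h0 := this (Set.mem_univ 0)
  simp at h0
  exact bE_zero n h0

lemma j0_zero {x : ℝ} (hx : 0 < x) (h : besselJ 0 x = 0) : 1 / 2 < x := by
  by_contra! hle
  rw [besselJ_zero_iff 0 hx] at h
  set t := (x / 2) ^ 2 with ht
  have ht0 : 0 ≤ t := by positivity
  have ht1 : t ≤ 1 / 16 := by nlinarith
  have hs := bE_summable 0 t
  unfold bE at h
  rw [hs.tsum_eq_zero_add] at h
  have hb : ‖∑' m : ℕ, bC 0 (m + 1) * t ^ (m + 1)‖ ≤ t * (1 - t)⁻¹ := by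
    apply tsum_of_norm_bounded ((hasSum_geometric_of_lt_one ht0 (by linarith)).mul_left t)
    intro m
    rw [Real.norm_eq_abs, abs_mul, abs_of_nonneg (by positivity : 0 ≤ t ^ (m + 1)), pow_succ']
    have h1 := bC_abs_le 0 (m + 1)
    have h2 : 1 / (Nat.factorial (m + 1) : ℝ) ≤ 1 := by
      rw [div_le_one (by positivity)]
      exact_mod_cast Nat.factorial_pos (m + 1)
    have h3 : 0 ≤ t * t ^ m := by positivity
    nlinarith
  have hb2 : t * (1 - t)⁻¹ < 1 := by
    rw [← div_eq_mul_inv, div_lt_one (by linarith)]; linarith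
  have h00 : bC 0 0 * t ^ 0 = 1 := by simp [bC]
  rw [h00] at h
  have := abs_le.1 (Real.norm_eq_abs _ ▸ hb)
  linarith [this.1]

/-- The analytic core. -/
lemma core (n : ℕ) (f g : ℝ → ℝ) (a b : ℝ) (ha : 0 < a) (hab : a < b)
    (hf : ∀ x, 0 < x → HasDerivAt f (n / x * f x - g x) x)
    (hg : ∀ x, 0 < x → HasDerivAt g (f x - (n + 1) / x * g x) x)
    (fa : f a = 0) (gb : g b = 0) (gpos : ∀ x, a ≤ x → x < b → 0 < g x) :
    b - a < Real.pi / 2 ∧ ((n : ℝ) + 1 / 2 < a → 1 < b - a) := by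
  have hpos : ∀ x ∈ Set.Icc a b, 0 < x := fun x hx => ha.trans_le hx.1
  have fneg : ∀ x, a < x → x ≤ b → f x < 0 := by
    have hanti : StrictAntiOn (fun x => f x / x ^ n) (Set.Icc a b) := by
      apply strictAntiOn_of_hasDerivWithinAt_neg (convex_Icc a b) (f' := fun x => - g x / x ^ n)
      · intro x hx
        have hx0 := hpos x hx
        exact ((hf x hx0).continuousAt.div (by fun_prop) (by positivity)).continuousWithinAt
      · intro x hx
        rw [interior_Icc] at hx
        have hx0 := hpos x ⟨hx.1.le, hx.2.le⟩
        have h := (hf x hx0).div (hasDerivAt_pow n x) (by positivity)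
        refine HasDerivAt.hasDerivWithinAt ?_
        refine HasDerivAt.congr_deriv h ?_
        rcases n with _ | n
        · simp
        · push_cast
          field_simp
          ring
      · intro x hx
        rw [interior_Icc] at hx
        have hx0 := hpos x ⟨hx.1.le, hx.2.le⟩
        have := gpos x hx.1.le hx.2
        have : 0 < g x / x ^ n := by positivity
        rw [neg_div]; linarith
    intro x hx hxb
    have h := hanti ⟨le_rfl, hab.le⟩ ⟨hx.le, hxb⟩ hx
    have hx0 := ha.trans hx
    simp only [fa, zero_div] at h
    by_contra! hc
    have : 0 ≤ f x / x ^ n := by positivity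
    linarith
  have hd : ∀ x ∈ Set.Icc a b, 0 < g x - f x := by
    intro x hx
    rcases eq_or_lt_of_le hx.1 with h | h
    · have := gpos x hx.1 (h ▸ hab)
      rw [← h] at this ⊢
      rw [fa]; linarith
    · have h1 := fneg x h hx.2
      rcases eq_or_lt_of_le hx.2 with h' | h'
      · rw [h'] at h1 ⊢
        rw [gb]; linarith
      · linarith [gpos x hx.1 h']
  constructor
  · have hanti : StrictAntiOn (fun x => Real.arctan ((f x + g x) / (g x - f x)) + x)
        (Set.Icc a b) := by
      apply strictAntiOn_of_hasDerivWithinAt_neg (convex_Icc a b)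
        (f' := fun x => ((2 * n + 1) / x * (f x * g x)) / (f x ^ 2 + g x ^ 2))
      · intro x hx
        have hx0 := hpos x hx
        have h1 := (hf x hx0).continuousAt
        have h2 := (hg x hx0).continuousAt
        refine ContinuousAt.continuousWithinAt ?_
        have h3 := (h1.add h2).div (h2.sub h1) (hd x hx).ne'
        exact (Real.continuous_arctan.continuousAt.comp h3).add continuousAt_id
      · intro x hx
        rw [interior_Icc] at hx
        have hx' : x ∈ Set.Icc a b := ⟨hx.1.le, hx.2.le⟩
        have hx0 := hpos x hx'
        have hdx := hd x hx'
        have h1 := hf x hx0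
        have h2 := hg x hx0
        have h3 := (((h1.add h2).div (h2.sub h1) hdx.ne').arctan).add (hasDerivAt_id x)
        refine HasDerivAt.hasDerivWithinAt ?_
        refine HasDerivAt.congr_deriv h3 ?_
        have hg0 := gpos x hx'.1 hx.2
        have hs : f x ^ 2 + g x ^ 2 ≠ 0 := by positivity
        have hq : 1 + ((f x + g x) / (g x - f x)) ^ 2
            = 2 * (f x ^ 2 + g x ^ 2) / (g x - f x) ^ 2 := by
          have := hdx.ne'
          field_simp
          ring
        simp only [Pi.add_apply, Pi.sub_apply, Pi.div_apply]
        rw [hq]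
        have := hdx.ne'
        field_simp
        ring
      · intro x hx
        rw [interior_Icc] at hx
        have hx0 := hpos x ⟨hx.1.le, hx.2.le⟩
        have hg0 := gpos x hx.1.le hx.2
        have hf0 := fneg x hx.1 hx.2.le
        apply div_neg_of_neg_of_pos _ (by positivity)
        exact mul_neg_of_pos_of_neg (by positivity) (mul_neg_of_neg_of_pos hf0 hg0)
    have h := hanti ⟨le_rfl, hab.le⟩ ⟨hab.le, le_rfl⟩ hab
    have hga := gpos a le_rfl hab
    have hfb := fneg b hab le_rfl
    have e1 : (f a + g a) / (g a - f a) = 1 := by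
      rw [fa]; simp [hga.ne']
    have e2 : (f b + g b) / (g b - f b) = -1 := by
      rw [gb, add_zero, zero_sub, div_neg, div_self hfb.ne]
    simp only [e1, e2, Real.arctan_one, Real.arctan_neg] at h
    linarith
  · intro hna
    have hmono : StrictMonoOn (fun x => g x / (g x - f x) + x) (Set.Icc a b) := by
      apply strictMonoOn_of_hasDerivWithinAt_pos (convex_Icc a b)
        (f' := fun x => (f x * g x) * ((2 * n + 1) / x - 2) / (g x - f x) ^ 2)
      · intro x hx
        have hx0 := hpos x hx
        have h1 := (hf x hx0).continuousAt
        have h2 := (hg x hx0).continuousAt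
        refine ContinuousAt.continuousWithinAt ?_
        exact (h2.div (h2.sub h1) (hd x hx).ne').add continuousAt_id
      · intro x hx
        rw [interior_Icc] at hx
        have hx' : x ∈ Set.Icc a b := ⟨hx.1.le, hx.2.le⟩
        have hx0 := hpos x hx'
        have hdx := hd x hx'
        have h1 := hf x hx0
        have h2 := hg x hx0
        have h3 := (h2.div (h2.sub h1) hdx.ne').add (hasDerivAt_id x)
        refine HasDerivAt.hasDerivWithinAt ?_
        refine HasDerivAt.congr_deriv h3 ?_
        simp only [Pi.sub_apply]
        have := hdx.ne'
        field_simp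
        ring
      · intro x hx
        rw [interior_Icc] at hx
        have hx' : x ∈ Set.Icc a b := ⟨hx.1.le, hx.2.le⟩
        have hx0 := hpos x hx'
        have hdx := hd x hx'
        have hg0 := gpos x hx.1.le hx.2
        have hf0 := fneg x hx.1 hx.2.le
        apply div_pos _ (by positivity)
        apply mul_pos_of_neg_of_neg (mul_neg_of_neg_of_pos hf0 hg0)
        have : (2 * (n : ℝ) + 1) / x < 2 := by
          rw [div_lt_iff₀ hx0]; linarith [hx.1]
        linarith
    have h := hmono ⟨le_rfl, hab.le⟩ ⟨hab.le, le_rfl⟩ hab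
    have hga := gpos a le_rfl hab
    simp only [fa, gb, sub_zero, div_self hga.ne', zero_div, zero_add] at h
    linarith

/-- Zero set below `x`. -/
def zS (n : ℕ) (x : ℝ) : Set ℝ := {y : ℝ | 0 < y ∧ y < x ∧ besselJ n y = 0}

lemma rolle_up (n : ℕ) {x y : ℝ} (hx : 0 ≤ x) (hxy : x < y)
    (h0 : x = 0 ∨ besselJ (n + 1) x = 0) (h1 : besselJ (n + 1) y = 0) :
    ∃ z, x < z ∧ z < y ∧ besselJ n z = 0 := by
  have hy : 0 < y := hx.trans_lt hxy
  rw [besselJ_zero_iff _ hy] at h1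
  obtain ⟨c, hc, hc0⟩ := exists_hasDerivAt_eq_zero hxy
    (fun z _ => (up_hasDerivAt n z).continuousAt.continuousWithinAt)
    (by
      rw [h1, mul_zero]
      rcases eq_or_lt_of_le hx with h | h
      · rw [← h]; simp
      · rw [besselJ_zero_iff _ h] at h0
        rcases h0 with h0 | h0
        · exact absurd h0 h.ne'
        · rw [h0, mul_zero])
    (fun z _ => up_hasDerivAt n z)
  have hcp : 0 < c := hx.trans_lt hc.1
  refine ⟨c, hc.1, hc.2, (besselJ_zero_iff n hcp).2 ?_⟩
  have : (c / 2) ^ (2 * n + 1) ≠ 0 := by positivity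
  simpa [this] using hc0

lemma rolle_down (n : ℕ) {x y : ℝ} (hx : 0 < x) (hxy : x < y)
    (h0 : besselJ n x = 0) (h1 : besselJ n y = 0) :
    ∃ z, x < z ∧ z < y ∧ besselJ (n + 1) z = 0 := by
  have hy : 0 < y := hx.trans hxy
  rw [besselJ_zero_iff _ hy] at h1
  rw [besselJ_zero_iff _ hx] at h0
  obtain ⟨c, hc, hc0⟩ := exists_hasDerivAt_eq_zero hxy
    (fun z _ => (bE_comp_hasDerivAt n z).continuousAt.continuousWithinAt)
    (by rw [h1, h0])
    (fun z _ => bE_comp_hasDerivAt n z)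
  have hcp : 0 < c := hx.trans hc.1
  refine ⟨c, hc.1, hc.2, (besselJ_zero_iff (n + 1) hcp).2 ?_⟩
  simpa [hcp.ne'] using hc0

lemma count_up (n : ℕ) {b : ℝ} (hb : 0 < b) (h : besselJ (n + 1) b = 0) :
    (zS (n + 1) b).ncard + 1 ≤ (zS n b).ncard := by
  classical
  have hf1 : (zS (n + 1) b).Finite := zeros_finite (n + 1) b
  have hf2 : (zS n b).Finite := zeros_finite n b
  rw [Set.ncard_eq_toFinset_card _ hf1, Set.ncard_eq_toFinset_card _ hf2]
  have hi := Finset.card_le_of_interleaved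
    (s := insert 0 (insert b hf1.toFinset)) (t := hf2.toFinset) (by
      intro x hx y hy hxy _
      simp only [Finset.mem_insert, Set.Finite.mem_toFinset] at hx hy
      have hx0 : 0 ≤ x := by
        rcases hx with rfl | rfl | hx
        exacts [le_rfl, hb.le, hx.1.le]
      have hyb : y ≤ b := by
        rcases hy with rfl | rfl | hy
        exacts [hb.le, le_rfl, hy.2.1.le]
      have hxz : x = 0 ∨ besselJ (n + 1) x = 0 := by
        rcases hx with rfl | rfl | hx
        exacts [Or.inl rfl, Or.inr h, Or.inr hx.2.2]
      have hyz : besselJ (n + 1) y = 0 := by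
        rcases hy with rfl | rfl | hy
        exacts [absurd hxy (not_lt.2 hx0), h, hy.2.2]
      obtain ⟨z, h1, h2, h3⟩ := rolle_up n hx0 hxy hxz hyz
      refine ⟨z, ?_, h1, h2⟩
      rw [Set.Finite.mem_toFinset]
      exact ⟨hx0.trans_lt h1, h2.trans_le hyb, h3⟩)
  rw [Finset.card_insert_of_notMem, Finset.card_insert_of_notMem] at hi
  · omega
  · rw [Set.Finite.mem_toFinset]
    exact fun hh => lt_irrefl _ hh.2.1
  · simp only [Finset.mem_insert, Set.Finite.mem_toFinset, not_or]
    exact ⟨hb.ne, fun hh => lt_irrefl _ hh.1⟩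

lemma count_down (n : ℕ) {a : ℝ} (ha : 0 < a) (h : besselJ n a = 0) :
    (zS n a).ncard ≤ (zS (n + 1) a).ncard := by
  classical
  have hf1 : (zS n a).Finite := zeros_finite n a
  have hf2 : (zS (n + 1) a).Finite := zeros_finite (n + 1) a
  rw [Set.ncard_eq_toFinset_card _ hf1, Set.ncard_eq_toFinset_card _ hf2]
  have hi := Finset.card_le_of_interleaved
    (s := insert a hf1.toFinset) (t := hf2.toFinset) (by
      have key : ∀ x ∈ insert a hf1.toFinset, 0 < x ∧ x ≤ a ∧ besselJ n x = 0 := by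
        intro x hx
        simp only [Finset.mem_insert, Set.Finite.mem_toFinset] at hx
        rcases hx with rfl | hx
        · exact ⟨ha, le_rfl, h⟩
        · exact ⟨hx.1, hx.2.1.le, hx.2.2⟩
      intro x hx y hy hxy _
      obtain ⟨hx0, _, hxz⟩ := key x hx
      obtain ⟨_, hya, hyz⟩ := key y hy
      obtain ⟨z, h1, h2, h3⟩ := rolle_down n hx0 hxy hxz hyz
      refine ⟨z, ?_, h1, h2⟩
      rw [Set.Finite.mem_toFinset]
      exact ⟨hx0.trans h1, h2.trans_le hya, h3⟩)
  rw [Finset.card_insert_of_notMem] at hi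
  · omega
  · rw [Set.Finite.mem_toFinset]
    exact fun hh => lt_irrefl _ hh.2.1

lemma step (n k : ℕ) (a b : ℝ) (ha : IsKthPosZero (besselJ n) k a)
    (hb : IsKthPosZero (besselJ (n + 1)) k b) :
    b - a < Real.pi / 2 ∧ ((n : ℝ) + 1 / 2 < a → 1 < b - a) := by
  obtain ⟨ha0, haz, hac⟩ := ha
  obtain ⟨hb0, hbz, hbc⟩ := hb
  change (zS n a).ncard = k - 1 at hac
  change (zS (n + 1) b).ncard = k - 1 at hbc
  have c1 := count_up n hb0 hbz
  have c2 := count_down n ha0 haz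
  have hab : a < b := by
    by_contra! hle
    have : (zS n b).ncard ≤ (zS n a).ncard :=
      Set.ncard_le_ncard (fun y hy => ⟨hy.1, hy.2.1.trans_le hle, hy.2.2⟩) (zeros_finite n a)
    omega
  have hEq : zS (n + 1) a = zS (n + 1) b :=
    Set.eq_of_subset_of_ncard_le (fun y hy => ⟨hy.1, hy.2.1.trans hab, hy.2.2⟩)
      (by omega) (zeros_finite (n + 1) b)
  have gne : ∀ x, a ≤ x → x < b → besselJ (n + 1) x ≠ 0 := by
    intro x hx hxb h0
    have : x ∈ zS (n + 1) b := ⟨ha0.trans_le hx, hxb, h0⟩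
    rw [← hEq] at this
    exact absurd this.2.1 (not_lt.2 hx)
  have hcont : ContinuousOn (besselJ (n + 1)) (Set.Ico a b) := fun x hx =>
    (besselJ_deriv (n + 1) (ha0.trans_le hx.1)).continuousAt.continuousWithinAt
  have hpre : IsPreconnected (Set.Ico a b) := isPreconnected_Ico
  have haa : a ∈ Set.Ico a b := ⟨le_rfl, hab⟩
  rcases lt_or_gt_of_ne (gne a le_rfl hab) with hs | hs
  · refine core n (fun x => - besselJ n x) (fun x => - besselJ (n + 1) x) a b ha0 hab ?_ ?_
      (by simp [haz]) (by simp [hbz]) ?_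
    · intro x hx
      refine HasDerivAt.congr_deriv (besselJ_deriv n hx).neg ?_
      ring
    · intro x hx
      refine HasDerivAt.congr_deriv (besselJ_deriv' n hx).neg ?_
      ring
    · intro x hx hxb
      by_contra! hc
      obtain ⟨z, hz, hz0⟩ := hpre.intermediate_value haa ⟨hx, hxb⟩ hcont
        (show (0 : ℝ) ∈ Set.Icc _ _ from ⟨hs.le, by linarith⟩)
      exact gne z hz.1 hz.2 hz0
  · refine core n (besselJ n) (besselJ (n + 1)) a b ha0 hab (fun x hx => besselJ_deriv n hx)
      (fun x hx => besselJ_deriv' n hx) haz hbz ?_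
    intro x hx hxb
    by_contra! hc
    obtain ⟨z, hz, hz0⟩ := hpre.intermediate_value ⟨hx, hxb⟩ haa hcont
      (show (0 : ℝ) ∈ Set.Icc _ _ from ⟨hc, hs.le⟩)
    exact gne z hz.1 hz.2 hz0

/-- For every nonnegative integer `n` and positive integer `k`, the `k`-th positive zeros
of consecutive Bessel functions satisfy `1 < j_{n+1,k} - j_{n,k} < π/2`. -/
theorem zero_difference (j : ℕ → ℕ → ℝ)
    (hj : ∀ n k, 1 ≤ k → IsKthPosZero (besselJ n) k (j n k)) :
    ∀ (n k : ℕ), 1 ≤ k →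
      1 < j (n + 1) k - j n k ∧ j (n + 1) k - j n k < Real.pi / 2 := by
  have hlow : ∀ n k : ℕ, 1 ≤ k → (n : ℝ) + 1 / 2 < j n k := by
    intro n k hk
    induction n with
    | zero =>
      have h := hj 0 k hk
      have := j0_zero h.1 h.2.1
      simpa using this
    | succ n ih =>
      have h := (step n k _ _ (hj n k hk) (hj (n + 1) k hk)).2 ih
      push_cast
      linarith
  intro n k hk
  have h := step n k _ _ (hj n k hk) (hj (n + 1) k hk)
  exact ⟨h.2 (hlow n k hk), h.1⟩
end

section
/- For all integers n ≥ 0 and k ≥ 1, the k-th positive zero of J_n satisfies n + k < j_{n,k} < π(n/2 + k) ≤ π(n + k). -/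
open Real MeasureTheory intervalIntegral

namespace BesselAux

/-- Entire companion series. -/
noncomputable def B (n : ℕ) (t : ℝ) : ℝ :=
  ∑' m : ℕ, (-t) ^ m / (Nat.factorial m * Nat.factorial (m + n))

lemma B_bound (n m : ℕ) (t : ℝ) :
    ‖(-t) ^ m / ((Nat.factorial m : ℝ) * Nat.factorial (m + n))‖ ≤ |t| ^ m / Nat.factorial m := by
  rw [norm_div, norm_pow, norm_neg, Real.norm_eq_abs, norm_mul]
  simp only [Real.norm_natCast]
  have h1 : (1 : ℝ) ≤ Nat.factorial (m + n) := by exact_mod_cast Nat.factorial_pos _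
  have h2 : (0 : ℝ) < Nat.factorial m := by exact_mod_cast Nat.factorial_pos _
  gcongr
  nlinarith

lemma B_summable (n : ℕ) (t : ℝ) :
    Summable (fun m : ℕ => (-t) ^ m / ((Nat.factorial m : ℝ) * Nat.factorial (m + n))) :=
  Summable.of_norm_bounded (Real.summable_pow_div_factorial |t|) (fun m => B_bound n m t)

lemma B_zero_zero : B 0 0 = 1 := by
  unfold B
  rw [tsum_eq_single 0]
  · simp
  · intro m hm
    simp [hm]

lemma B_hasDerivAt (n : ℕ) (t : ℝ) : HasDerivAt (B n) (-B (n + 1) t) t := by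
  set R : ℝ := |t| + 1
  have hR : 0 ≤ R := by positivity
  have key := hasDerivAt_tsum_of_isPreconnected
    (u := fun m : ℕ => R ^ (m - 1) / Nat.factorial (m - 1))
    (g := fun (m : ℕ) (t : ℝ) => (-t) ^ m / ((Nat.factorial m : ℝ) * Nat.factorial (m + n)))
    (g' := fun (m : ℕ) (t : ℝ) =>
      (m * (-t) ^ (m - 1) * (-1)) / ((Nat.factorial m : ℝ) * Nat.factorial (m + n)))
    (t := Metric.ball 0 R) (y₀ := t) (y := t)
    ((summable_nat_add_iff 1).1 (by simpa using Real.summable_pow_div_factorial R))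
    Metric.isOpen_ball (convex_ball _ _).isPreconnected ?_ ?_ ?_ (B_summable n t) ?_
  · have e : ∑' m : ℕ, (m * (-t) ^ (m - 1) * (-1)) / ((Nat.factorial m : ℝ) * Nat.factorial (m + n))
        = -B (n + 1) t := by
      rw [tsum_eq_zero_add']
      · unfold B
        rw [← tsum_neg]
        simp only [Nat.cast_zero, zero_mul, zero_div, zero_add]
        refine tsum_congr fun m => ?_
        rw [Nat.factorial_succ, show m + 1 + n = m + (n + 1) by ring]
        have : (m : ℝ) + 1 ≠ 0 := by positivity
        have h1 : (Nat.factorial m : ℝ) ≠ 0 := by positivity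
        have h2 : (Nat.factorial (m + (n + 1)) : ℝ) ≠ 0 := by positivity
        simp only [Nat.add_sub_cancel]
        push_cast
        field_simp
      · refine (B_summable (n + 1) t).neg.congr fun m => ?_
        rw [Nat.factorial_succ, show m + 1 + n = m + (n + 1) by ring]
        have : (m : ℝ) + 1 ≠ 0 := by positivity
        have h1 : (Nat.factorial m : ℝ) ≠ 0 := by positivity
        have h2 : (Nat.factorial (m + (n + 1)) : ℝ) ≠ 0 := by positivity
        simp only [Nat.add_sub_cancel]
        push_cast
        field_simp
    rw [e] at key
    exact key
  · intro m y hy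
    have := ((hasDerivAt_id y).neg.pow m).div_const ((Nat.factorial m : ℝ) * Nat.factorial (m + n))
    simpa using this
  · intro m y hy
    rcases m with _ | m
    · simp
    · have hy' : |y| ≤ R := by simpa using (Metric.mem_ball.1 hy).le
      have e : ((m + 1 : ℕ) * (-y) ^ (m + 1 - 1) * (-1)) /
          ((Nat.factorial (m + 1) : ℝ) * Nat.factorial (m + 1 + n))
          = - ((-y) ^ m / ((Nat.factorial m : ℝ) * Nat.factorial (m + (n + 1)))) := by
        rw [Nat.factorial_succ, show m + 1 + n = m + (n + 1) by ring]
        have : (m : ℝ) + 1 ≠ 0 := by positivity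
        have h1 : (Nat.factorial m : ℝ) ≠ 0 := by positivity
        have h2 : (Nat.factorial (m + (n + 1)) : ℝ) ≠ 0 := by positivity
        simp only [Nat.add_sub_cancel]
        push_cast
        field_simp
      rw [e, norm_neg]
      refine (B_bound (n + 1) m y).trans ?_
      simp only [Nat.add_sub_cancel]
      gcongr
  · simp [R]
  · simp [R]

lemma B_rec (n : ℕ) (t : ℝ) : B n t = (n + 1) * B (n + 1) t - t * B (n + 2) t := by
  have s2 := B_summable (n + 2) t
  have e1 : (n + 1) * B (n + 1) t - t * B (n + 2) t =
      ∑' m : ℕ, ((n + 1) * ((-t) ^ m / ((Nat.factorial m : ℝ) * Nat.factorial (m + (n + 1))))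
        + (m * ((-t) ^ m / ((Nat.factorial m : ℝ) * Nat.factorial (m + (n + 1)))))) := by
    have e : ∀ m : ℕ, ((m + 1 : ℕ) * ((-t) ^ (m + 1) /
          ((Nat.factorial (m + 1) : ℝ) * Nat.factorial (m + 1 + (n + 1)))))
        = (-t) * ((-t) ^ m / ((Nat.factorial m : ℝ) * Nat.factorial (m + (n + 2)))) := by
      intro m
      rw [Nat.factorial_succ, show m + 1 + (n + 1) = m + (n + 2) by ring]
      have : (m : ℝ) + 1 ≠ 0 := by positivity
      have h1 : (Nat.factorial m : ℝ) ≠ 0 := by positivity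
      have h2 : (Nat.factorial (m + (n + 2)) : ℝ) ≠ 0 := by positivity
      push_cast
      field_simp
      ring
    have s3 : Summable (fun m : ℕ =>
        (m * ((-t) ^ m / ((Nat.factorial m : ℝ) * Nat.factorial (m + (n + 1)))))) := by
      refine (summable_nat_add_iff 1).1 ?_
      exact (s2.mul_left (-t)).congr (fun m => (e m).symm)
    rw [Summable.tsum_add ((B_summable (n + 1) t).mul_left _) s3, tsum_mul_left, s3.tsum_eq_zero_add]
    simp_rw [e]
    rw [tsum_mul_left]
    unfold B
    simp
    ring
  rw [e1]
  unfold B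
  refine tsum_congr fun m => ?_
  rw [show m + (n + 1) = (m + n) + 1 by ring, Nat.factorial_succ]
  have : ((m + n : ℕ) : ℝ) + 1 ≠ 0 := by positivity
  have h1 : (Nat.factorial m : ℝ) ≠ 0 := by positivity
  have h2 : (Nat.factorial (m + n) : ℝ) ≠ 0 := by positivity
  push_cast at this ⊢
  field_simp
  ring

lemma J_eq (n : ℕ) (x : ℝ) : besselJ n x = (x / 2) ^ n * B n (x ^ 2 / 4) := by
  unfold besselJ B
  rw [← tsum_mul_left]
  refine tsum_congr fun m => ?_
  rw [show -(x ^ 2 / 4) = (-1) * (x / 2) ^ 2 by ring, mul_pow, ← pow_mul, pow_add]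
  ring

lemma J_cont (n : ℕ) : Continuous (besselJ n) := by
  have h : Continuous (B n) := continuous_iff_continuousAt.2 fun t => (B_hasDerivAt n t).continuousAt
  have : besselJ n = fun x => (x / 2) ^ n * B n (x ^ 2 / 4) := funext (J_eq n)
  rw [this]
  fun_prop

lemma J_zero_zero : besselJ 0 0 = 1 := by
  simp [J_eq, B_zero_zero]

lemma J_hasDerivAt (n : ℕ) {x : ℝ} (hx : 0 < x) :
    HasDerivAt (besselJ n) ((n * besselJ n x - x * besselJ (n + 1) x) / x) x := by
  have e : besselJ n = fun x => (x / 2) ^ n * B n (x ^ 2 / 4) := funext (J_eq n)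
  have h1 : HasDerivAt (fun x : ℝ => x ^ 2 / 4) (x / 2) x := by
    have := (hasDerivAt_pow 2 x).div_const 4
    refine this.congr_deriv ?_
    norm_num; ring
  have h2 := (B_hasDerivAt n (x ^ 2 / 4)).comp x h1
  have h3 : HasDerivAt (fun x : ℝ => (x / 2) ^ n) (n * (x / 2) ^ n / x) x := by
    have := ((hasDerivAt_id x).div_const 2).pow n
    refine this.congr_deriv ?_
    rcases n with _ | n
    · simp
    · simp only [id, Nat.add_sub_cancel]
      field_simp
      ring
  have h4 := h3.mul h2
  rw [J_eq n x, J_eq (n + 1) x, e]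
  refine h4.congr_deriv ?_
  simp only [Function.comp]
  field_simp
  ring

lemma J_rec (n : ℕ) (x : ℝ) :
    x * besselJ n x = 2 * (n + 1) * besselJ (n + 1) x - x * besselJ (n + 2) x := by
  rw [J_eq, J_eq, J_eq, B_rec n]
  ring

lemma J_hasDerivAt' (n : ℕ) {x : ℝ} (hx : 0 < x) :
    HasDerivAt (besselJ (n + 1)) ((x * besselJ n x - (n + 1) * besselJ (n + 1) x) / x) x := by
  convert J_hasDerivAt (n + 1) hx using 2
  have := J_rec n x
  push_cast
  linarith

/-- The function x times the derivative of J_n at x. -/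
noncomputable def P (n : ℕ) (x : ℝ) : ℝ := n * besselJ n x - x * besselJ (n + 1) x

lemma P_cont (n : ℕ) : Continuous (P n) := by
  unfold P
  have := J_cont n
  have := J_cont (n + 1)
  fun_prop

lemma P_hasDerivAt (n : ℕ) {x : ℝ} (hx : 0 < x) :
    HasDerivAt (P n) ((n ^ 2 / x - x) * besselJ n x) x := by
  have h := ((J_hasDerivAt n hx).const_mul (n : ℝ)).sub ((hasDerivAt_id x).mul (J_hasDerivAt' n hx))
  refine (h.congr_deriv ?_)
  simp only [id]
  field_simp
  ring

lemma lemL {f p q : ℝ → ℝ} {c b M : ℝ} (hc : 0 ≤ c) (hcb : c < b) (hb : b ≤ c + 1) (hM : 0 < M)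
    (hf : ContinuousOn f (Set.Icc c b)) (hp : ContinuousOn p (Set.Icc c b))
    (hfc : f c = M) (hpc : 0 ≤ p c)
    (hf' : ∀ x ∈ Set.Ioo c b, HasDerivAt f (p x / x) x)
    (hp' : ∀ x ∈ Set.Ioo c b, HasDerivAt p (q x) x)
    (hq : ∀ x ∈ Set.Ioo c b, -x * M ≤ q x) : 0 < f b := by
  have m1 : MonotoneOn (fun x => p x + M * (x ^ 2 - c ^ 2) / 2) (Set.Icc c b) := by
    refine monotoneOn_of_hasDerivWithinAt_nonneg (convex_Icc c b) (by fun_prop)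
      (f' := fun x => q x + M * x) ?_ ?_
    · intro x hx
      rw [interior_Icc] at hx
      have h1 : HasDerivAt (fun x : ℝ => M * (x ^ 2 - c ^ 2) / 2) (M * x) x := by
        have := ((((hasDerivAt_pow 2 x).sub_const (c ^ 2)).const_mul M).div_const 2)
        refine this.congr_deriv ?_
        norm_num; ring
      exact ((hp' x hx).add h1).hasDerivWithinAt
    · intro x hx
      rw [interior_Icc] at hx
      have := hq x hx
      linarith
  have hpx : ∀ x ∈ Set.Ioo c b, -(M * (x ^ 2 - c ^ 2) / 2) ≤ p x := by
    intro x hx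
    have := m1 (Set.left_mem_Icc.2 hcb.le) (Set.Ioo_subset_Icc_self hx) hx.1.le
    simp only at this
    linarith
  have m2 : MonotoneOn (fun x => f x + M * (x - c) ^ 2 / 2) (Set.Icc c b) := by
    refine monotoneOn_of_hasDerivWithinAt_nonneg (convex_Icc c b) (by fun_prop)
      (f' := fun x => p x / x + M * (x - c)) ?_ ?_
    · intro x hx
      rw [interior_Icc] at hx
      have h1 : HasDerivAt (fun x : ℝ => M * (x - c) ^ 2 / 2) (M * (x - c)) x := by
        have := (((((hasDerivAt_id x).sub_const c).pow 2).const_mul M).div_const 2)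
        refine this.congr_deriv ?_
        simp only [id]
        norm_num; ring
      exact ((hf' x hx).add h1).hasDerivWithinAt
    · intro x hx
      rw [interior_Icc] at hx
      have h1 := hpx x hx
      have hx0 : 0 < x := lt_of_le_of_lt hc hx.1
      have h2 : 0 ≤ x * (p x / x + M * (x - c)) := by
        have : x * (p x / x + M * (x - c)) = p x + M * (x - c) * x := by field_simp
        rw [this]
        nlinarith [mul_nonneg hM.le (sq_nonneg (x - c))]
      exact nonneg_of_mul_nonneg_right h2 hx0
  have := m2 (Set.left_mem_Icc.2 hcb.le) (Set.right_mem_Icc.2 hcb.le) hcb.le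
  simp only [sub_self] at this
  have h3 : (b - c) ^ 2 ≤ 1 := by nlinarith
  nlinarith

/-- The main positivity step beyond `x = n`. -/
lemma pos_step (n : ℕ) (h0 : 0 < besselJ n n) (hP : 0 ≤ P n n) :
    ∀ z : ℝ, (n : ℝ) ≤ z → z ≤ n + 1 → 0 < besselJ n z := by
  intro z hz hz1
  by_contra hneg
  have hn0 : (0 : ℝ) ≤ n := Nat.cast_nonneg n
  have hcn : ContinuousOn (besselJ n) (Set.Icc (n : ℝ) z) := (J_cont n).continuousOn
  obtain ⟨c, hc, hmax⟩ := isCompact_Icc.exists_isMaxOn (Set.nonempty_Icc.2 hz) hcn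
  have hM : 0 < besselJ n c := h0.trans_le (hmax (Set.left_mem_Icc.2 hz))
  have hcz : c < z := by
    rcases hc.2.lt_or_eq with h | h
    · exact h
    · exact absurd (h ▸ hM) hneg
  have hPc : 0 ≤ P n c := by
    rcases hc.1.lt_or_eq with h | h
    · have hc0 : 0 < c := lt_of_le_of_lt hn0 h
      have hl : IsLocalMax (besselJ n) c := hmax.isLocalMax (Icc_mem_nhds h hcz)
      have := hl.hasDerivAt_eq_zero (J_hasDerivAt n hc0)
      have h2 : P n c = 0 := by
        unfold P
        rcases div_eq_zero_iff.1 this with h | h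
        · exact h
        · exact absurd h hc0.ne'
      exact h2.ge
    · rw [← h]; exact hP
  refine hneg (lemL (f := besselJ n) (p := P n) (q := fun x => (n ^ 2 / x - x) * besselJ n x)
    (hn0.trans hc.1) hcz (by linarith [hc.1]) hM (J_cont n).continuousOn (P_cont n).continuousOn
    rfl hPc ?_ ?_ ?_)
  · intro x hx
    exact J_hasDerivAt n (lt_of_le_of_lt (hn0.trans hc.1) hx.1)
  · intro x hx
    exact P_hasDerivAt n (lt_of_le_of_lt (hn0.trans hc.1) hx.1)
  · intro x hx
    have hx0 : 0 < x := lt_of_le_of_lt (hn0.trans hc.1) hx.1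
    have hnx : (n : ℝ) ≤ x := hc.1.trans hx.1.le
    have h1 : besselJ n x ≤ besselJ n c := hmax ⟨hnx, hx.2.le⟩
    have h2 : (n : ℝ) ^ 2 / x ≤ x := by
      rw [div_le_iff₀ hx0]; nlinarith
    have h3 : 0 ≤ (n : ℝ) ^ 2 / x := by positivity
    nlinarith [mul_nonneg (sub_nonneg.2 h2) (sub_nonneg.2 h1), mul_nonneg h3 hM.le]

lemma J_pos (n : ℕ) : ∀ z : ℝ, 0 < z → z ≤ n + 1 → 0 < besselJ n z := by
  induction n with
  | zero =>
    intro z hz hz1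
    refine pos_step 0 (by simp [J_zero_zero]) ?_ z (by simpa using hz.le) hz1
    simp [P]
  | succ n ih =>
    have hlow : ∀ z : ℝ, 0 < z → z ≤ n + 1 → 0 < besselJ (n + 1) z := by
      intro z hz hz1
      have sm : StrictMonoOn (fun x => x ^ (n + 1) * besselJ (n + 1) x) (Set.Icc 0 z) := by
        have := J_cont (n + 1)
        refine strictMonoOn_of_hasDerivWithinAt_pos (convex_Icc 0 z) (by fun_prop)
          (f' := fun x => x ^ (n + 1) * besselJ n x) ?_ ?_
        · intro x hx
          rw [interior_Icc] at hx
          have h := (hasDerivAt_pow (n + 1) x).mul (J_hasDerivAt' n hx.1)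
          have hx0 := hx.1
          refine (h.congr_deriv ?_).hasDerivWithinAt
          simp only [Nat.add_sub_cancel]
          push_cast
          field_simp
          ring
        · intro x hx
          rw [interior_Icc] at hx
          have := ih x hx.1 (hx.2.le.trans hz1)
          have := hx.1
          positivity
      have := sm (Set.left_mem_Icc.2 hz.le) (Set.right_mem_Icc.2 hz.le) hz
      simp only [zero_pow (Nat.succ_ne_zero n), zero_mul] at this
      exact pos_of_mul_pos_right this (by positivity)
    intro z hz hz1
    rcases le_total z (n + 1) with h | h
    · exact hlow z hz h
    · refine pos_step (n + 1) ?_ ?_ z (by push_cast; exact h) hz1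
      · push_cast
        exact hlow _ (by positivity) le_rfl
      · have mo : MonotoneOn (P (n + 1)) (Set.Icc (0 : ℝ) (n + 1)) := by
          refine monotoneOn_of_hasDerivWithinAt_nonneg (convex_Icc _ _) (P_cont _).continuousOn
            (f' := fun x => (((n + 1 : ℕ) : ℝ) ^ 2 / x - x) * besselJ (n + 1) x) ?_ ?_
          · intro x hx
            rw [interior_Icc] at hx
            exact (P_hasDerivAt (n + 1) hx.1).hasDerivWithinAt
          · intro x hx
            rw [interior_Icc] at hx
            refine mul_nonneg ?_ (hlow x hx.1 hx.2.le).le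
            rw [sub_nonneg, le_div_iff₀ hx.1]
            push_cast
            nlinarith [hx.1, hx.2]
        have hn1 : (0 : ℝ) ≤ n + 1 := by positivity
        have := mo (Set.left_mem_Icc.2 hn1) (Set.right_mem_Icc.2 hn1) hn1
        have e : P (n + 1) 0 = 0 := by simp [P, J_eq]
        rw [e] at this
        push_cast
        exact this

lemma zero_gt (n : ℕ) {z : ℝ} (hz : 0 < z) (h : besselJ n z = 0) : (n : ℝ) + 1 < z := by
  by_contra hc
  exact (J_pos n z hz (not_lt.1 hc)).ne' h

lemma not_both (n : ℕ) {z : ℝ} (hz : 0 < z) (h : besselJ n z = 0) : besselJ (n + 1) z ≠ 0 := by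
  intro h1
  have key : ∀ m, besselJ (n + m) z = 0 ∧ besselJ (n + m + 1) z = 0 := by
    intro m
    induction m with
    | zero => exact ⟨h, h1⟩
    | succ m ih =>
      refine ⟨ih.2, ?_⟩
      have := J_rec (n + m) z
      rw [ih.1, ih.2] at this
      have h2 : z * besselJ (n + m + 2) z = 0 := by linarith
      exact (mul_eq_zero.1 h2).resolve_left hz.ne'
  obtain ⟨m, hm⟩ := exists_nat_gt z
  have := zero_gt (n + m) hz (key m).1
  push_cast at this
  have : (0 : ℝ) ≤ n := Nat.cast_nonneg n
  linarith

lemma spacing (n : ℕ) {a b : ℝ} (ha : 0 < a) (hab : a < b) (hfa : besselJ n a = 0)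
    (hfb : besselJ n b = 0) : a + 1 < b := by
  by_contra hlt
  rw [not_lt] at hlt
  have hna := zero_gt n ha hfa
  have hn0 : (0 : ℝ) ≤ n := Nat.cast_nonneg n
  obtain ⟨c, hc, hmax⟩ := isCompact_Icc.exists_isMaxOn (Set.nonempty_Icc.2 hab.le)
    (f := fun x => besselJ n x ^ 2) ((J_cont n).pow 2).continuousOn
  have hM : besselJ n c ≠ 0 := by
    intro h0
    have hz : ∀ x ∈ Set.Icc a b, besselJ n x = 0 := by
      intro x hx
      have := hmax hx
      simp only [Set.mem_ofPred_eq, h0] at this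
      nlinarith
    have hmid : (a + b) / 2 ∈ Set.Ioo a b := ⟨by linarith, by linarith⟩
    have hm0 : 0 < (a + b) / 2 := by linarith
    have hd := J_hasDerivAt n hm0
    have hd0 : HasDerivAt (besselJ n) 0 ((a + b) / 2) := by
      refine (hasDerivAt_const ((a + b) / 2) (0 : ℝ)).congr_of_eventuallyEq ?_
      filter_upwards [Icc_mem_nhds hmid.1 hmid.2] with x hx using hz x hx
    have h := hd.unique hd0
    have hm := hz _ (Set.Ioo_subset_Icc_self hmid)
    refine not_both n hm0 hm ?_
    rw [hm] at h
    rcases div_eq_zero_iff.1 h with h | h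
    · have h : (a + b) / 2 * besselJ (n + 1) ((a + b) / 2) = 0 := by linarith
      exact (mul_eq_zero.1 h).resolve_left hm0.ne'
    · exact absurd h hm0.ne'
  have hac : a < c := by
    rcases hc.1.lt_or_eq with h | h
    · exact h
    · exact absurd (h ▸ hfa) hM
  have hcb : c < b := by
    rcases hc.2.lt_or_eq with h | h
    · exact h
    · exact absurd (h ▸ hfb) hM
  have hc0 : 0 < c := ha.trans hac
  have hPc : P n c = 0 := by
    have hl : IsLocalMax (fun x => besselJ n x ^ 2) c := hmax.isLocalMax (Icc_mem_nhds hac hcb)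
    have := hl.hasDerivAt_eq_zero ((J_hasDerivAt n hc0).pow 2)
    unfold P
    have h3 : (n * besselJ n c - c * besselJ (n + 1) c) / c = 0 := by
      simpa [hM] using this
    exact (div_eq_zero_iff.1 h3).resolve_right hc0.ne'
  obtain ⟨s, hs1, hs⟩ : ∃ s : ℝ, s ^ 2 = 1 ∧ 0 < s * besselJ n c := by
    rcases lt_or_gt_of_ne hM with h | h
    · exact ⟨-1, by norm_num, by linarith⟩
    · exact ⟨1, by norm_num, by linarith⟩
  have := lemL (f := fun x => s * besselJ n x) (p := fun x => s * P n x)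
    (q := fun x => s * ((n ^ 2 / x - x) * besselJ n x))
    hc0.le hcb (by linarith) hs ((J_cont n).const_mul s).continuousOn
    ((P_cont n).const_mul s).continuousOn rfl (by simp [hPc])
    (fun x hx => ?_) (fun x hx => (P_hasDerivAt n (hc0.trans hx.1)).const_mul s) ?_
  · simp [hfb] at this
  · rw [mul_div_assoc]
    exact (J_hasDerivAt n (hc0.trans hx.1)).const_mul s
  · intro x hx
    have hx0 : 0 < x := hc0.trans hx.1
    have hnx : (n : ℝ) ≤ x := by linarith [hx.1]
    have h1 : (s * besselJ n x) ^ 2 ≤ (s * besselJ n c) ^ 2 := by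
      have : besselJ n x ^ 2 ≤ besselJ n c ^ 2 := hmax ⟨hac.le.trans hx.1.le, hx.2.le⟩
      rw [mul_pow, mul_pow, hs1]; linarith
    have h1' : s * besselJ n x ≤ s * besselJ n c := abs_le_of_sq_le_sq' h1 hs.le |>.2
    have h2 : (n : ℝ) ^ 2 / x ≤ x := by
      rw [div_le_iff₀ hx0]; nlinarith
    have h3 : 0 ≤ (n : ℝ) ^ 2 / x := by positivity
    nlinarith [mul_nonneg (sub_nonneg.2 h2) (sub_nonneg.2 h1'), mul_nonneg h3 hs.le]

lemma zeros_finite (n : ℕ) (b : ℝ) : {y : ℝ | 0 < y ∧ y < b ∧ besselJ n y = 0}.Finite := by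
  refine Set.Finite.of_finite_image (f := fun x : ℝ => ⌊x⌋)
    ((Set.finite_Icc (0 : ℤ) ⌊b⌋).subset ?_) ?_
  · rintro _ ⟨x, hx, rfl⟩
    exact ⟨Int.floor_nonneg.2 hx.1.le, Int.floor_mono hx.2.1.le⟩
  · intro x hx y hy hxy
    have := Int.abs_sub_lt_one_of_floor_eq_floor hxy
    rw [abs_lt] at this
    rcases lt_trichotomy x y with h | h | h
    · have := spacing n hx.1 h hx.2.2 hy.2.2
      linarith
    · exact h
    · have := spacing n hy.1 h hy.2.2 hx.2.2
      linarith

/-- A nonvanishing continuous function on an interval has constant sign. -/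
lemma const_sign {f : ℝ → ℝ} (hf : Continuous f) {a b : ℝ}
    (h : ∀ x ∈ Set.Ioo a b, f x ≠ 0) :
    ∃ s : ℝ, (s = 1 ∨ s = -1) ∧ ∀ x ∈ Set.Ioo a b, 0 < s * f x := by
  by_cases hp : ∃ x ∈ Set.Ioo a b, 0 < f x
  · obtain ⟨x, hx, hfx⟩ := hp
    refine ⟨1, Or.inl rfl, fun y hy => ?_⟩
    by_contra hneg
    have h0 : (0 : ℝ) ∈ Set.Icc (f y) (f x) := ⟨by linarith, hfx.le⟩
    obtain ⟨z, hz, hz0⟩ := isPreconnected_Ioo.intermediate_value hy hx hf.continuousOn h0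
    exact h z hz hz0
  · refine ⟨-1, Or.inr rfl, fun y hy => ?_⟩
    have h1 := h y hy
    have h2 : f y ≤ 0 := not_lt.1 fun h3 => hp ⟨y, hy, h3⟩
    have := lt_of_le_of_ne h2 h1
    linarith

lemma nonneg_left {f : ℝ → ℝ} (hf : Continuous f) {a b : ℝ} (hab : a < b)
    (h : ∀ x ∈ Set.Ioo a b, 0 < f x) : ∀ x ∈ Set.Icc a b, 0 ≤ f x := by
  intro x hx
  have hcl : Set.Icc a b ⊆ {x | 0 ≤ f x} := by
    rw [← closure_Ioo hab.ne]
    exact closure_minimal (fun y hy => (h y hy).le) (isClosed_le continuous_const hf)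
  exact hcl hx

/-- Wronskian of `√x J_0` with `sin`. -/
noncomputable def W (x : ℝ) : ℝ :=
  √x * (besselJ 0 x * cos x + besselJ 1 x * sin x) - besselJ 0 x * (√x * sinc x) / 2

lemma W_cont : Continuous W := by
  unfold W
  have := J_cont 0
  have := J_cont 1
  have := Real.continuous_sinc
  fun_prop

lemma W_hasDerivAt {x : ℝ} (hx : 0 < x) :
    HasDerivAt W (√x * besselJ 0 x * sin x / (4 * x ^ 2)) x := by
  have e : W =ᶠ[nhds x] fun x =>
      √x * (besselJ 0 x * cos x + besselJ 1 x * sin x) - besselJ 0 x * (√x * (sin x / x)) / 2 := by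
    filter_upwards [lt_mem_nhds hx] with y hy
    rw [W, Real.sinc_of_ne_zero hy.ne']
  have hs := Real.hasDerivAt_sqrt hx.ne'
  have h0 := J_hasDerivAt 0 hx
  have h1 := J_hasDerivAt' 0 hx
  have h := (hs.mul ((h0.mul (Real.hasDerivAt_cos x)).add (h1.mul (Real.hasDerivAt_sin x)))).sub
    ((h0.mul (hs.mul ((Real.hasDerivAt_sin x).div (hasDerivAt_id x) hx.ne'))).div_const 2)
  refine (h.congr_of_eventuallyEq e).congr_deriv ?_
  have hq : 0 < √x := Real.sqrt_pos.2 hx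
  obtain ⟨r, hr⟩ : ∃ r, r = √x := ⟨_, rfl⟩
  have hx2 : x = r ^ 2 := by rw [hr, Real.sq_sqrt hx.le]
  have hr0 : r ≠ 0 := by rw [hr]; exact hq.ne'
  simp only [Pi.mul_apply, Pi.add_apply, Pi.div_apply, id, zero_add]
  generalize besselJ 0 x = A
  generalize besselJ 1 x = C
  generalize sin x = S
  generalize cos x = T
  rw [← hr]
  clear h h0 h1 hs e hr hq
  subst hx2
  field_simp
  push_cast
  ring

lemma sqrt_sinc {x : ℝ} (h : sin x = 0) : √x * sinc x = 0 := by
  by_cases hx : x = 0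
  · simp [hx]
  · rw [Real.sinc_of_ne_zero hx, h]; simp

/-- `(-1)^m sin > 0` on `(π m, π (m+1))`. -/
lemma sin_sign (m : ℕ) {x : ℝ} (hx : x ∈ Set.Ioo (π * m) (π * (m + 1))) :
    0 < (-1) ^ m * sin x := by
  rw [← Real.sin_sub_nat_mul_pi]
  exact Real.sin_pos_of_pos_of_lt_pi (by linarith [hx.1]) (by linarith [hx.2])

lemma sin_pi_mul (m : ℕ) : sin (π * m) = 0 := by rw [mul_comm]; exact Real.sin_nat_mul_pi m
lemma cos_pi_mul (m : ℕ) : cos (π * m) = (-1) ^ m := by rw [mul_comm]; exact Real.cos_nat_mul_pi m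

lemma W_pi (m : ℕ) : W (π * m) = √(π * m) * besselJ 0 (π * m) * (-1) ^ m := by
  rw [W, sqrt_sinc (sin_pi_mul m), sin_pi_mul, cos_pi_mul]; ring

lemma W_mono (m : ℕ) {s b : ℝ} (hb : b ≤ π * (m + 1))
    (hs : ∀ x ∈ Set.Ioo (π * m) b, 0 < s * besselJ 0 x) :
    StrictMonoOn (fun x => s * (-1) ^ m * W x) (Set.Icc (π * m) b) := by
  have := W_cont
  refine strictMonoOn_of_hasDerivWithinAt_pos (convex_Icc _ _) (by fun_prop)
    (f' := fun x => s * (-1) ^ m * (√x * besselJ 0 x * sin x / (4 * x ^ 2))) ?_ ?_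
  · intro x hx
    rw [interior_Icc] at hx
    have hx0 : 0 < x := lt_of_le_of_lt (by positivity) hx.1
    exact ((W_hasDerivAt hx0).const_mul _).hasDerivWithinAt
  · intro x hx
    rw [interior_Icc] at hx
    have hx0 : 0 < x := lt_of_le_of_lt (by positivity) hx.1
    have h1 := hs x hx
    have h2 := sin_sign m ⟨hx.1, hx.2.trans_le hb⟩
    have e : s * (-1) ^ m * (√x * besselJ 0 x * sin x / (4 * x ^ 2)) =
      √x / (4 * x ^ 2) * (s * besselJ 0 x) * ((-1) ^ m * sin x) := by ring
    rw [e]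
    have := Real.sqrt_pos.2 hx0
    positivity

lemma neg_one_sq_pow (m : ℕ) : ((-1 : ℝ) ^ m) * (-1) ^ m = 1 := by
  rw [← mul_pow]; norm_num

lemma J0_zero (m : ℕ) : ∃ z ∈ Set.Ioo (π * m) (π * (m + 1)), besselJ 0 z = 0 := by
  by_contra hno
  push Not at hno
  obtain ⟨s, -, hs⟩ := const_sign (J_cont 0) hno
  have hlt : π * (m : ℝ) < π * (m + 1) := by nlinarith [Real.pi_pos]
  have hnn := nonneg_left ((J_cont 0).const_mul s) hlt hs
  have mo := W_mono m le_rfl hs (Set.left_mem_Icc.2 hlt.le) (Set.right_mem_Icc.2 hlt.le) hlt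
  have h1 := hnn _ (Set.left_mem_Icc.2 hlt.le)
  have h2 := hnn _ (Set.right_mem_Icc.2 hlt.le)
  have e2 := W_pi (m + 1)
  push_cast at e2
  simp only at mo
  rw [W_pi m, e2] at mo
  have hp := neg_one_sq_pow m
  have a1 : s * (-1) ^ m * (√(π * m) * besselJ 0 (π * m) * (-1) ^ m) =
    √(π * m) * (s * besselJ 0 (π * m)) := by
    linear_combination (√(π * m) * (s * besselJ 0 (π * m))) * hp
  have a2 : s * (-1) ^ m * (√(π * (m + 1)) * besselJ 0 (π * (m + 1)) * (-1) ^ (m + 1)) =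
    -(√(π * (m + 1)) * (s * besselJ 0 (π * (m + 1)))) := by
    rw [pow_succ]
    linear_combination -(√(π * (m + 1)) * (s * besselJ 0 (π * (m + 1)))) * hp
  rw [a1, a2] at mo
  have b1 := mul_nonneg (Real.sqrt_nonneg (π * m)) h1
  have b2 := mul_nonneg (Real.sqrt_nonneg (π * (m + 1))) h2
  linarith

lemma J1_zero (k : ℕ) {a b : ℝ} (ha : 0 < a) (hak : a < π * k) (hab : a < b)
    (hfa : besselJ 0 a = 0) (hfb : besselJ 0 b = 0)
    (hno : ∀ x ∈ Set.Ioo a b, besselJ 0 x ≠ 0) :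
    ∃ z ∈ Set.Ioo a b, z < π * (k + 1 / 2) ∧ besselJ 1 z = 0 := by
  have hpi := Real.pi_pos
  have hd : ∀ x, 0 < x → HasDerivAt (besselJ 0) (-besselJ 1 x) x := by
    intro x hx
    refine (J_hasDerivAt 0 hx).congr_deriv ?_
    simp only [zero_add]
    field_simp
    push_cast
    ring
  obtain ⟨D, hD⟩ : ∃ D, D = π * ((k : ℝ) + 1 / 2) := ⟨_, rfl⟩
  rw [← hD]
  rcases le_or_gt b D with hbB | hBb
  · obtain ⟨z, hz, hz0⟩ := exists_hasDerivAt_eq_zero hab (J_cont 0).continuousOn (hfa.trans hfb.symm)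
      (fun x hx => hd x (ha.trans hx.1))
    exact ⟨z, hz, hz.2.trans_le hbB, by linarith⟩
  · by_contra hcon
    have hg : ∀ x ∈ Set.Ioo a D, besselJ 1 x ≠ 0 := fun x hx h =>
      hcon ⟨x, ⟨hx.1, hx.2.trans hBb⟩, hx.2, h⟩
    have hkD : π * (k : ℝ) < D := by rw [hD]; nlinarith
    have haD : a < D := hak.trans hkD
    obtain ⟨s, -, hs⟩ := const_sign (J_cont 0) hno
    obtain ⟨t, ht, hts⟩ := const_sign (J_cont 1) hg
    -- `s * J_1 ≤ 0` at `D`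
    obtain ⟨z, hz, hz0⟩ := exists_hasDerivAt_eq_slope (fun x => s * besselJ 0 x)
      (fun x => s * (-besselJ 1 x)) haD ((J_cont 0).const_mul s).continuousOn
      (fun x hx => (hd x (ha.trans hx.1)).const_mul s)
    have hfD := hs D ⟨haD, hBb⟩
    have hzneg : s * besselJ 1 z < 0 := by
      have : 0 < s * (-besselJ 1 z) := by
        rw [hz0, hfa]
        refine div_pos (by linarith) (by linarith)
      linarith
    have hgD : s * besselJ 1 D ≤ 0 := by
      have h1 := nonneg_left ((J_cont 1).const_mul t) haD hts D (Set.right_mem_Icc.2 haD.le)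
      have h2 := hts z hz
      have h3 : t * t = 1 := by rcases ht with h | h <;> rw [h] <;> norm_num
      have h4 : (s * besselJ 1 D) * (t * besselJ 1 z) ≤ 0 := by
        have : (s * besselJ 1 D) * (t * besselJ 1 z) = (s * besselJ 1 z) * (t * besselJ 1 D) := by ring
        rw [this]
        exact mul_nonpos_of_nonpos_of_nonneg hzneg.le h1
      by_contra hpos
      exact absurd (mul_pos (not_le.1 hpos) h2) (not_lt.2 h4)
    have mo := W_mono k (s := s) (b := D) (by rw [hD]; nlinarith)
      (fun x hx => hs x ⟨hak.trans hx.1, hx.2.trans hBb⟩)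
      (Set.left_mem_Icc.2 hkD.le) (Set.right_mem_Icc.2 hkD.le) hkD
    have hD0 : 0 < D := ha.trans haD
    have hk0 : 0 < π * (k : ℝ) := ha.trans hak
    have hp := neg_one_sq_pow k
    have hsinD : sin D = (-1) ^ k := by
      rw [hD, show π * ((k : ℝ) + 1 / 2) = π / 2 + k * π by ring, Real.sin_add_nat_mul_pi]
      simp
    have hcosD : cos D = 0 := by
      rw [hD, show π * ((k : ℝ) + 1 / 2) = π / 2 + k * π by ring, Real.cos_add_nat_mul_pi]
      simp
    simp only at mo
    rw [W_pi k, W, Real.sinc_of_ne_zero hD0.ne', hsinD, hcosD] at mo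
    have a1 : s * (-1) ^ k * (√(π * k) * besselJ 0 (π * k) * (-1) ^ k) =
      √(π * k) * (s * besselJ 0 (π * k)) := by
      linear_combination (√(π * k) * (s * besselJ 0 (π * k))) * hp
    have a2 : s * (-1) ^ k * (√D * (besselJ 0 D * 0 + besselJ 1 D * (-1) ^ k) -
        besselJ 0 D * (√D * ((-1) ^ k / D)) / 2) =
        √D * (s * besselJ 1 D) - √D / (2 * D) * (s * besselJ 0 D) := by
      linear_combination (√D * (s * besselJ 1 D) - √D / (2 * D) * (s * besselJ 0 D)) * hp
    rw [a1, a2] at mo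
    have b1 := mul_pos (Real.sqrt_pos.2 hk0) (hs _ ⟨hak, hkD.trans hBb⟩)
    have b2 := mul_nonneg (Real.sqrt_nonneg D) (neg_nonneg.2 hgD)
    have b3 : 0 < √D / (2 * D) * (s * besselJ 0 D) := by
      have := Real.sqrt_pos.2 hD0
      positivity
    linarith

/-- Between consecutive zeros of `J_n` there is a zero of `J_{n+2}`. -/
lemma J_add_two_zero (n : ℕ) {a b : ℝ} (ha : 0 < a) (hab : a < b)
    (hfa : besselJ n a = 0) (hfb : besselJ n b = 0)
    (hno : ∀ x ∈ Set.Ioo a b, besselJ n x ≠ 0) :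
    ∃ z ∈ Set.Ioo a b, besselJ (n + 2) z = 0 := by
  have hb := ha.trans hab
  obtain ⟨s, hs1, hs⟩ := const_sign (J_cont n) hno
  have hs0 : s ≠ 0 := by rcases hs1 with h | h <;> rw [h] <;> norm_num
  have da : HasDerivAt (fun x => s * besselJ n x) (s * -besselJ (n + 1) a) a := by
    refine ((J_hasDerivAt n ha).const_mul s).congr_deriv ?_
    rw [hfa]; field_simp; ring
  have db : HasDerivAt (fun x => s * besselJ n x) (s * -besselJ (n + 1) b) b := by
    refine ((J_hasDerivAt n hb).const_mul s).congr_deriv ?_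
    rw [hfb]; field_simp; ring
  have h1 : 0 ≤ s * -besselJ (n + 1) a := by
    have ht := (hasDerivAt_iff_tendsto_slope.1 da).mono_left
      (nhdsWithin_mono a (fun x (hx : x ∈ Set.Ioi a) => ne_of_gt hx))
    refine ge_of_tendsto ht ?_
    filter_upwards [Ioo_mem_nhdsGT hab] with x hx
    rw [slope_def_field, hfa]
    exact div_nonneg (by linarith [hs x hx]) (by linarith [hx.1])
  have h2 : s * -besselJ (n + 1) b ≤ 0 := by
    have ht := (hasDerivAt_iff_tendsto_slope.1 db).mono_left
      (nhdsWithin_mono b (fun x (hx : x ∈ Set.Iio b) => ne_of_lt hx))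
    refine le_of_tendsto ht ?_
    filter_upwards [Ioo_mem_nhdsLT hab] with x hx
    rw [slope_def_field, hfb]
    exact div_nonpos_of_nonneg_of_nonpos (by linarith [hs x hx]) (by linarith [hx.2])
  have h1' : s * besselJ (n + 1) a < 0 :=
    lt_of_le_of_ne (by linarith) (mul_ne_zero hs0 (not_both n ha hfa))
  have h2' : 0 < s * besselJ (n + 1) b :=
    lt_of_le_of_ne (by linarith) (mul_ne_zero hs0 (not_both n hb hfb)).symm
  have ra := J_rec n a
  have rb := J_rec n b
  rw [hfa] at ra
  rw [hfb] at rb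
  have hn : (0 : ℝ) < 2 * (n + 1) := by positivity
  have k1 : s * besselJ (n + 2) a < 0 := by
    have : a * (s * besselJ (n + 2) a) < 0 := by
      have : a * (s * besselJ (n + 2) a) = 2 * (n + 1) * (s * besselJ (n + 1) a) := by
        linear_combination s * ra
      rw [this]
      exact mul_neg_of_pos_of_neg hn h1'
    exact neg_of_mul_neg_right this ha.le
  have k2 : 0 < s * besselJ (n + 2) b := by
    have : 0 < b * (s * besselJ (n + 2) b) := by
      have : b * (s * besselJ (n + 2) b) = 2 * (n + 1) * (s * besselJ (n + 1) b) := by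
        linear_combination s * rb
      rw [this]
      exact mul_pos hn h2'
    exact pos_of_mul_pos_right this hb.le
  obtain ⟨z, hz, hz0⟩ := intermediate_value_Ioo hab.le
    ((J_cont (n + 2)).const_mul s).continuousOn (Set.mem_Ioo.2 ⟨k1, k2⟩)
  exact ⟨z, hz, (mul_eq_zero.1 hz0).resolve_left hs0⟩

section counting

lemma count {n k : ℕ} {x b : ℝ} (hx : IsKthPosZero (besselJ n) k x) (hk : 1 ≤ k) (d : ℕ → ℝ)
    (hd : Monotone d) (hd0 : 0 ≤ d 0)
    (h : ∀ i < k, ∃ z ∈ Set.Ioo (d i) (d (i + 1)), z < b ∧ besselJ n z = 0) : x < b := by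
  by_contra hbx
  rw [not_lt] at hbx
  choose! c hc hcb hc0 using h
  have hsub : c '' (Finset.range k : Set ℕ) ⊆ {y : ℝ | 0 < y ∧ y < x ∧ besselJ n y = 0} := by
    rintro _ ⟨i, hi, rfl⟩
    have hi : i < k := by simpa using hi
    exact ⟨lt_of_le_of_lt (hd0.trans (hd (Nat.zero_le i))) (hc i hi).1,
      (hcb i hi).trans_le hbx, hc0 i hi⟩
  have hlt : ∀ p q, p < k → q < k → p < q → c p < c q := fun p q hp hq hpq =>
    (hc p hp).2.trans_le ((hd (Nat.succ_le_of_lt hpq)).trans (hc q hq).1.le)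
  have hinj : Set.InjOn c (Finset.range k : Set ℕ) := by
    intro p hp q hq hpq
    have hp : p < k := by simpa using hp
    have hq : q < k := by simpa using hq
    rcases lt_trichotomy p q with h | h | h
    · exact absurd hpq (hlt p q hp hq h).ne
    · exact h
    · exact absurd hpq (hlt q p hq hp h).ne'
  have h1 := Set.ncard_le_ncard hsub (zeros_finite n x)
  rw [hinj.ncard_image, Set.ncard_coe_finset, Finset.card_range, hx.2.2] at h1
  omega

lemma j_lt {j : ℕ → ℕ → ℝ} (hj : ∀ n k, 1 ≤ k → IsKthPosZero (besselJ n) k (j n k))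
    (n : ℕ) {k : ℕ} (hk : 1 ≤ k) : j n k < j n (k + 1) := by
  by_contra h
  rw [not_lt] at h
  have h1 := Set.ncard_le_ncard (s := {y : ℝ | 0 < y ∧ y < j n (k + 1) ∧ besselJ n y = 0})
    (t := {y : ℝ | 0 < y ∧ y < j n k ∧ besselJ n y = 0}) (fun y hy => ⟨hy.1, hy.2.1.trans_le h, hy.2.2⟩) (zeros_finite n (j n k))
  rw [(hj n k hk).2.2, (hj n (k + 1) (by omega)).2.2] at h1
  omega

lemma j_consec {j : ℕ → ℕ → ℝ} (hj : ∀ n k, 1 ≤ k → IsKthPosZero (besselJ n) k (j n k))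
    (n : ℕ) {k : ℕ} (hk : 1 ≤ k) :
    ∀ x ∈ Set.Ioo (j n k) (j n (k + 1)), besselJ n x ≠ 0 := by
  intro x hx h0
  have a := hj n k hk
  have b := hj n (k + 1) (by omega)
  have hx1 := hx.1
  have hx2 := hx.2
  have hsub : insert x (insert (j n k) {y : ℝ | 0 < y ∧ y < j n k ∧ besselJ n y = 0}) ⊆
      {y : ℝ | 0 < y ∧ y < j n (k + 1) ∧ besselJ n y = 0} := by
    rintro y (rfl | rfl | hy)
    · exact ⟨a.1.trans hx1, hx2, h0⟩
    · exact ⟨a.1, hx1.trans hx2, a.2.1⟩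
    · exact ⟨hy.1, hy.2.1.trans (hx1.trans hx2), hy.2.2⟩
  have h1 := Set.ncard_le_ncard hsub (zeros_finite n _)
  rw [Set.ncard_insert_of_notMem _ ((zeros_finite n _).insert _),
    Set.ncard_insert_of_notMem _ (zeros_finite n _), a.2.2, b.2.2] at h1
  · omega
  · rintro ⟨_, h, _⟩
    exact lt_irrefl _ h
  · rintro (h | ⟨_, h, _⟩)
    · exact hx1.ne' h
    · exact lt_asymm h hx1

lemma j_mono {j : ℕ → ℕ → ℝ} (hj : ∀ n k, 1 ≤ k → IsKthPosZero (besselJ n) k (j n k))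
    (n : ℕ) : Monotone (fun i => j n (i + 1)) :=
  monotone_nat_of_le_succ fun i => (j_lt hj n (by omega)).le

lemma upper {j : ℕ → ℕ → ℝ} (hj : ∀ n k, 1 ≤ k → IsKthPosZero (besselJ n) k (j n k))
    (n : ℕ) : ∀ k, 1 ≤ k → j n k < π * ((n : ℝ) / 2 + k) := by
  have hpi := Real.pi_pos
  have h0 : ∀ k, 1 ≤ k → j 0 k < π * k := by
    intro k hk
    refine count (hj 0 k hk) hk (fun i => π * i) (fun p q hpq => ?_) (by simp) ?_
    · have : (p : ℝ) ≤ q := by exact_mod_cast hpq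
      exact mul_le_mul_of_nonneg_left this hpi.le
    · intro i hi
      obtain ⟨z, hz, hz0⟩ := J0_zero i
      refine ⟨z, by push_cast; exact hz, hz.2.trans_le ?_, hz0⟩
      have : (i : ℝ) + 1 ≤ k := by exact_mod_cast hi
      exact mul_le_mul_of_nonneg_left this hpi.le
  induction n using Nat.strong_induction_on with
  | _ n ih =>
    rcases n with _ | _ | n
    · intro k hk
      simpa using h0 k hk
    · intro k hk
      refine count (hj 1 k hk) hk (fun i => j 0 (i + 1)) (j_mono hj 0) (hj 0 1 le_rfl).1.le ?_
      intro i hi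
      obtain ⟨z, hz, hz1, hz0⟩ := J1_zero (i + 1) (hj 0 (i + 1) (by omega)).1 (h0 (i + 1) (by omega))
        (j_lt hj 0 (by omega)) (hj 0 (i + 1) (by omega)).2.1 (hj 0 (i + 1 + 1) (by omega)).2.1
        (j_consec hj 0 (by omega))
      refine ⟨z, hz, hz1.trans_le ?_, hz0⟩
      have : (i : ℝ) + 1 ≤ k := by exact_mod_cast hi
      push_cast
      refine mul_le_mul_of_nonneg_left ?_ hpi.le
      linarith
    · intro k hk
      have h1 : j (n + 2) k < j n (k + 1) := by
        refine count (hj (n + 2) k hk) hk (fun i => j n (i + 1)) (j_mono hj n)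
          (hj n 1 le_rfl).1.le ?_
        intro i hi
        obtain ⟨z, hz, hz0⟩ := J_add_two_zero n (hj n (i + 1) (by omega)).1
          (j_lt hj n (by omega)) (hj n (i + 1) (by omega)).2.1 (hj n (i + 1 + 1) (by omega)).2.1
          (j_consec hj n (by omega))
        exact ⟨z, hz, hz.2.trans_le (j_mono hj n (Nat.succ_le_of_lt hi)), hz0⟩
      have h2 := ih n (by omega) (k + 1) (by omega)
      refine (h1.trans h2).trans_le (le_of_eq ?_)
      push_cast
      ring

lemma lower {j : ℕ → ℕ → ℝ} (hj : ∀ n k, 1 ≤ k → IsKthPosZero (besselJ n) k (j n k))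
    (n : ℕ) : ∀ k, 1 ≤ k → (n : ℝ) + k < j n k := by
  intro k hk
  induction k, hk using Nat.le_induction with
  | base =>
    have := zero_gt n (hj n 1 le_rfl).1 (hj n 1 le_rfl).2.1
    simpa using this
  | succ k hk ih =>
    have := spacing n (hj n k hk).1 (j_lt hj n hk) (hj n k hk).2.1 (hj n (k + 1) (by omega)).2.1
    push_cast
    linarith

end counting

end BesselAux

/-- For all `n ≥ 0` and `k ≥ 1`: `n + k < j n k < π (n/2 + k) ≤ π (n + k)`. -/
theorem jnk_range (j : ℕ → ℕ → ℝ)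
    (hj : ∀ n k, 1 ≤ k → IsKthPosZero (besselJ n) k (j n k)) :
    ∀ (n k : ℕ), 1 ≤ k →
      (n + k : ℝ) < j n k ∧ j n k < Real.pi * ((n : ℝ) / 2 + k) ∧
        Real.pi * ((n : ℝ) / 2 + k) ≤ Real.pi * ((n : ℝ) + k) := by
  intro n k hk
  refine ⟨BesselAux.lower hj n k hk, BesselAux.upper hj n k hk, ?_⟩
  have : (0 : ℝ) ≤ n := Nat.cast_nonneg n
  exact mul_le_mul_of_nonneg_left (by linarith) Real.pi_pos.le
end
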